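/- arXiv:1205.1069 — 2 statements merged into one kernel-verified Lean document; each statement's English description precedes it below -/
import Mathlib

section
/- For each e ≥ 1, let B_e be the positive fourth root of inf{ −(2^{e+1}/3^e) ∏_{j=1}^e x_j + 2 ∏_{j=1}^e Ω(1/x_j, 0) + ∏_{j=1}^e Ω(1/x_j, 1 + 2y_j/x_j) : x_1,…,x_e > 0, y_1,…,y_e ∈ ℝ }. Then: (103/89)^{1/4} < B_1 < (22/19)^{1/4}; (86/65)^{1/4} < B_2 < (75/56)^{1/4}; (142/95)^{1/4} < B_3 < (116/77)^{1/4}; (100/61)^{1/4} < B_4 < (107/65)^{1/4}; (7/4)^{1/4} < B_5 < (128/73)^{1/4}; and (7/4)^{1/4} < B_e < 2^{1/4} for every e ≥ 6. -/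
/-- `Omega x y = ∑_{n ∈ ℤ} max(0, 1 - |x n - y|)^2`. -/
noncomputable def Omega (x y : ℝ) : ℝ := ∑' n : ℤ, max 0 (1 - |x * (n : ℝ) - y|) ^ 2

/-- `Bquart e` is the infimum of the limiting values of `(‖f‖₄/‖f‖₂)⁴` over size- and
translation-stable families of `e`-variable quadratic multiplicative character polynomials. -/
noncomputable def Bquart (e : ℕ) : ℝ :=
  sInf {r : ℝ | ∃ x y : Fin e → ℝ, (∀ j, 0 < x j) ∧
    r = -((2 : ℝ) ^ (e + 1) / 3 ^ e) * ∏ j, x j + 2 * ∏ j, Omega (1 / x j) 0 +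
      ∏ j, Omega (1 / x j) (1 + 2 * y j / x j)}

/-- `B_e` is the positive fourth root of `Bquart e`. -/
noncomputable def Bconst (e : ℕ) : ℝ := Bquart e ^ ((1 : ℝ) / 4)

theorem univariate_two {v : ℝ} (h0 : 0 ≤ v) (h1 : v ≤ 27 / 100) :
    1325 / 1000 ≤ 2 * (1 + 2 * v ^ 2) ^ 2 - 2 * (2 / 3 / (1 - v)) ^ 2 + ((1 + v) ^ 2 / 2) ^ 2 := by
  have hv : 0 < 1 - v := by linarith
  have key : 2 * (2 / 3) ^ 2 ≤
      (2 * (1 + 2 * v ^ 2) ^ 2 + ((1 + v) ^ 2 / 2) ^ 2 - 1325 / 1000) * (1 - v) ^ 2 := by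
    nlinarith [sq_nonneg (v - 6 / 100), mul_nonneg h0 (sq_nonneg (v - 6 / 100)),
      pow_nonneg h0 3, pow_nonneg h0 4, pow_nonneg h0 5, mul_nonneg h0 (sub_nonneg.2 h1)]
  have := (div_le_iff₀ (by positivity)).2 key
  rw [div_pow]
  linarith [mul_div_assoc (2 : ℝ) ((2 / 3) ^ 2) ((1 - v) ^ 2)]

theorem univariate_three {v : ℝ} (h0 : 0 ≤ v) (h1 : v ≤ 27 / 100) :
    1497 / 1000 ≤ 2 * (1 + 2 * v ^ 2) ^ 3 - 2 * (2 / 3 / (1 - v)) ^ 3 + ((1 + v) ^ 2 / 2) ^ 3 := by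
  have hv : 0 < 1 - v := by linarith
  have hA : 1 + 6 * v ^ 2 ≤ (1 + 2 * v ^ 2) ^ 3 := by
    have : 0 ≤ 12 * v ^ 4 + 8 * v ^ 6 := by positivity
    linarith
  have hM : (1 + 6 * v + 15 * v ^ 2) / 8 ≤ ((1 + v) ^ 2 / 2) ^ 3 := by
    have : 0 ≤ 20 * v ^ 3 + 15 * v ^ 4 + 6 * v ^ 5 + v ^ 6 := by positivity
    linarith
  have key : 2 * (2 / 3) ^ 3 ≤
      (2 * (1 + 6 * v ^ 2) + (1 + 6 * v + 15 * v ^ 2) / 8 - 1497 / 1000) * (1 - v) ^ 3 := by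
    nlinarith [sq_nonneg (v - 5 / 100), mul_nonneg h0 (sq_nonneg (v - 5 / 100)),
      pow_nonneg h0 3, pow_nonneg h0 4, pow_nonneg h0 5, mul_nonneg h0 (sub_nonneg.2 h1)]
  have := (div_le_iff₀ (by positivity)).2 key
  rw [div_pow]
  linarith [mul_div_assoc (2 : ℝ) ((2 / 3) ^ 3) ((1 - v) ^ 3)]

theorem univariate_four {v : ℝ} (h0 : 0 ≤ v) (h1 : v ≤ 27 / 100) :
    1641 / 1000 ≤ 2 * (1 + 2 * v ^ 2) ^ 4 - 2 * (2 / 3 / (1 - v)) ^ 4 + ((1 + v) ^ 2 / 2) ^ 4 := by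
  have hv : 0 < 1 - v := by linarith
  have hA : 1 + 8 * v ^ 2 + 24 * v ^ 4 ≤ (1 + 2 * v ^ 2) ^ 4 := by
    have : 0 ≤ 32 * v ^ 6 + 16 * v ^ 8 := by positivity
    linarith
  have hM : (1 + 8 * v + 28 * v ^ 2 + 56 * v ^ 3) / 16 ≤ ((1 + v) ^ 2 / 2) ^ 4 := by
    have : 0 ≤ 70 * v ^ 4 + 56 * v ^ 5 + 28 * v ^ 6 + 8 * v ^ 7 + v ^ 8 := by positivity
    linarith
  have key : 2 * (2 / 3) ^ 4 ≤
      (2 * (1 + 8 * v ^ 2 + 24 * v ^ 4) + (1 + 8 * v + 28 * v ^ 2 + 56 * v ^ 3) / 16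
        - 1641 / 1000) * (1 - v) ^ 4 := by
    nlinarith [sq_nonneg (v - 4 / 100), mul_nonneg h0 (sq_nonneg (v - 4 / 100)),
      pow_nonneg h0 3, pow_nonneg h0 4, pow_nonneg h0 5, mul_nonneg h0 (sub_nonneg.2 h1)]
  have := (div_le_iff₀ (by positivity)).2 key
  rw [div_pow]
  linarith [mul_div_assoc (2 : ℝ) ((2 / 3) ^ 4) ((1 - v) ^ 4)]

theorem univariate_five {v : ℝ} (h0 : 0 ≤ v) (h1 : v ≤ 27 / 100) :
    1751 / 1000 ≤ 2 * (1 + 2 * v ^ 2) ^ 5 - 2 * (2 / 3 / (1 - v)) ^ 5 + ((1 + v) ^ 2 / 2) ^ 5 := by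
  have hv : 0 < 1 - v := by linarith
  have hA : 1 + 10 * v ^ 2 + 40 * v ^ 4 ≤ (1 + 2 * v ^ 2) ^ 5 := by
    have : 0 ≤ 80 * v ^ 6 + 80 * v ^ 8 + 32 * v ^ 10 := by positivity
    linarith
  have hM : (1 + 10 * v + 45 * v ^ 2 + 120 * v ^ 3) / 32 ≤ ((1 + v) ^ 2 / 2) ^ 5 := by
    have : 0 ≤ 210 * v ^ 4 + 252 * v ^ 5 + 210 * v ^ 6 + 120 * v ^ 7 + 45 * v ^ 8 + 10 * v ^ 9 +
      v ^ 10 := by positivity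
    linarith
  have key : 2 * (2 / 3) ^ 5 ≤
      (2 * (1 + 10 * v ^ 2 + 40 * v ^ 4) + (1 + 10 * v + 45 * v ^ 2 + 120 * v ^ 3) / 32
        - 1751 / 1000) * (1 - v) ^ 5 := by
    nlinarith [sq_nonneg (v - 3 / 100), mul_nonneg h0 (sq_nonneg (v - 3 / 100)),
      pow_nonneg h0 3, pow_nonneg h0 4, pow_nonneg h0 5, mul_nonneg h0 (sub_nonneg.2 h1)]
  have := (div_le_iff₀ (by positivity)).2 key
  rw [div_pow]
  linarith [mul_div_assoc (2 : ℝ) ((2 / 3) ^ 5) ((1 - v) ^ 5)]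

theorem prod_form_mono {ι : Type*} {a d m a' d' m' : ι → ℝ} (s : Finset ι)
    (hda : ∀ j ∈ s, d' j ≤ a' j) (hmd : ∀ j ∈ s, m' j ≤ d' j) (hm : ∀ j ∈ s, 0 ≤ m' j)
    (h₁ : ∀ j ∈ s, a' j ≤ a j) (h₂ : ∀ j ∈ s, a' j - d' j ≤ a j - d j)
    (h₃ : ∀ j ∈ s, 2 * a' j - 2 * d' j + m' j ≤ 2 * a j - 2 * d j + m j)
    (hda₀ : ∀ j ∈ s, d j ≤ a j) (hmd₀ : ∀ j ∈ s, m j ≤ d j) (hm₀ : ∀ j ∈ s, 0 ≤ m j)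
    {P Q R : ℝ} (hQP : Q ≤ P) (hRQ : R ≤ Q) (hR : 0 ≤ R) :
    2 * (P * ∏ j ∈ s, a' j) - 2 * (Q * ∏ j ∈ s, d' j) + R * ∏ j ∈ s, m' j ≤
      2 * (P * ∏ j ∈ s, a j) - 2 * (Q * ∏ j ∈ s, d j) + R * ∏ j ∈ s, m j := by
  classical
  induction s using Finset.induction_on generalizing P Q R with
  | empty => simp
  | insert i s hi ih =>
    simp only [Finset.forall_mem_insert] at hda hmd hm h₁ h₂ h₃ hda₀ hmd₀ hm₀
    have hd₀ : 0 ≤ d i := hm₀.1.trans hmd₀.1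
    have ih' := ih hda.2 hmd.2 hm.2 h₁.2 h₂.2 h₃.2 hda₀.2 hmd₀.2 hm₀.2
      (P := P * a i) (Q := Q * d i) (R := R * m i)
      (mul_le_mul hQP hda₀.1 hd₀ (by linarith)) (mul_le_mul hRQ hmd₀.1 hm₀.1 (by linarith))
      (mul_nonneg hR hm₀.1)
    have hM : 0 ≤ ∏ j ∈ s, m' j := Finset.prod_nonneg hm.2
    have hMD : ∏ j ∈ s, m' j ≤ ∏ j ∈ s, d' j := Finset.prod_le_prod hm.2 hmd.2
    have hDA : ∏ j ∈ s, d' j ≤ ∏ j ∈ s, a' j :=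
      Finset.prod_le_prod (fun j hj => (hm.2 j hj).trans (hmd.2 j hj)) hda.2
    rw [Finset.prod_insert hi, Finset.prod_insert hi, Finset.prod_insert hi,
      Finset.prod_insert hi, Finset.prod_insert hi, Finset.prod_insert hi]
    generalize ∏ j ∈ s, m' j = M at *
    generalize ∏ j ∈ s, d' j = D at *
    generalize ∏ j ∈ s, a' j = A at *
    have hPA : Q * D ≤ P * A := mul_le_mul hQP hDA (hM.trans hMD) (by linarith)
    have hQD : R * M ≤ Q * D := mul_le_mul hRQ hMD hM (by linarith)
    have hRM : 0 ≤ R * M := mul_nonneg hR hM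
    have e₁ := mul_nonneg (sub_nonneg.2 hPA) (sub_nonneg.2 h₁.1)
    have e₂ := mul_nonneg (sub_nonneg.2 hQD) (sub_nonneg.2 h₂.1)
    have e₃ := mul_nonneg hRM (sub_nonneg.2 h₃.1)
    linarith

theorem prod_form_erase {ι : Type*} [DecidableEq ι] {a d m : ι → ℝ} {s : Finset ι}
    (hda : ∀ j ∈ s, d j ≤ a j) (hmd : ∀ j ∈ s, m j ≤ d j) (hm : ∀ j ∈ s, 0 ≤ m j)
    {i : ι} (hi : i ∈ s) {r : ℝ} (ha : r ≤ a i) (hg : r ≤ 2 * a i - 2 * d i + m i) :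
    r * (2 * ∏ j ∈ s.erase i, a j - 2 * ∏ j ∈ s.erase i, d j + ∏ j ∈ s.erase i, m j) ≤
      2 * ∏ j ∈ s, a j - 2 * ∏ j ∈ s, d j + ∏ j ∈ s, m j := by
  have hsub : ∀ j ∈ s.erase i, j ∈ s := fun j hj => Finset.mem_of_mem_erase hj
  have hM : 0 ≤ ∏ j ∈ s.erase i, m j := Finset.prod_nonneg fun j hj => hm j (hsub j hj)
  have hMD : ∏ j ∈ s.erase i, m j ≤ ∏ j ∈ s.erase i, d j :=
    Finset.prod_le_prod (fun j hj => hm j (hsub j hj)) fun j hj => hmd j (hsub j hj)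
  have hDA : ∏ j ∈ s.erase i, d j ≤ ∏ j ∈ s.erase i, a j :=
    Finset.prod_le_prod (fun j hj => (hm j (hsub j hj)).trans (hmd j (hsub j hj)))
      fun j hj => hda j (hsub j hj)
  rw [← Finset.mul_prod_erase s a hi, ← Finset.mul_prod_erase s d hi,
    ← Finset.mul_prod_erase s m hi]
  generalize ∏ j ∈ s.erase i, m j = M at *
  generalize ∏ j ∈ s.erase i, d j = D at *
  generalize ∏ j ∈ s.erase i, a j = A at *
  have e₁ := mul_nonneg (sub_nonneg.2 hDA) (sub_nonneg.2 ha)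
  have e₂ := mul_nonneg (sub_nonneg.2 hMD) (sub_nonneg.2 (hda i hi))
  have e₃ := mul_nonneg hM (sub_nonneg.2 hg)
  linarith

/-- The value of the quartic form at `x j = 1 / (1 - v j)` for `v j ∈ [0, 1/3]`. -/
noncomputable def boxForm {ι : Type*} (s : Finset ι) (v : ι → ℝ) : ℝ :=
  2 * ∏ j ∈ s, (1 + 2 * v j ^ 2) - 2 * ∏ j ∈ s, 2 / 3 / (1 - v j) + ∏ j ∈ s, (1 + v j) ^ 2 / 2

theorem pair_smoothing {a b w P Q R : ℝ} (ha : a ∈ Set.Icc (0 : ℝ) (27 / 100))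
    (hb : b ∈ Set.Icc (0 : ℝ) (27 / 100)) (hw : w ∈ Set.Icc (0 : ℝ) (27 / 100))
    (hab : a ≠ b) (h : (1 - w) * (1 - w) = (1 - a) * (1 - b)) (hP : 0 < P) (hRP : R ≤ P) :
    2 * ((1 + 2 * w ^ 2) * ((1 + 2 * w ^ 2) * P)) - 2 * (2 / 3 / (1 - w) * (2 / 3 / (1 - w) * Q))
        + (1 + w) ^ 2 / 2 * ((1 + w) ^ 2 / 2 * R) <
      2 * ((1 + 2 * a ^ 2) * ((1 + 2 * b ^ 2) * P)) - 2 * (2 / 3 / (1 - a) * (2 / 3 / (1 - b) * Q))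
        + (1 + a) ^ 2 / 2 * ((1 + b) ^ 2 / 2 * R) := by
  obtain ⟨ha0, ha1⟩ := ha
  obtain ⟨hb0, hb1⟩ := hb
  obtain ⟨hw0, hw1⟩ := hw
  have hD : 2 / 3 / (1 - w) * (2 / 3 / (1 - w) * Q) = 2 / 3 / (1 - a) * (2 / 3 / (1 - b) * Q) := by
    have e : ∀ s t : ℝ, 2 / 3 / s * (2 / 3 / t * Q) = 4 / 9 * Q / (s * t) := fun s t => by
      simp only [div_eq_mul_inv, mul_inv]
      ring
    rw [e, e, h]
  rw [hD]
  obtain ⟨δ, hδ⟩ : ∃ δ, δ = w ^ 2 - a * b := ⟨_, rfl⟩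
  have hs : 2 * w = a + b + δ := by rw [hδ]; linarith
  have hδ0 : 0 < δ := by
    have hsq : 0 < (a - b) ^ 2 := by have := sub_ne_zero.2 hab; positivity
    by_contra hneg
    nlinarith [mul_self_le_mul_self (show 0 ≤ (1 - a + (1 - b)) / 2 by linarith)
      (show (1 - a + (1 - b)) / 2 ≤ 1 - w by linarith)]
  have hA : (1 + 2 * a ^ 2) * (1 + 2 * b ^ 2) - (1 + 2 * w ^ 2) * (1 + 2 * w ^ 2) =
      δ * (4 - 2 * (a + b + 2 * w) - 4 * (a * b + w ^ 2)) := by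
    have hw2 : w ^ 2 = a * b + δ := by linarith
    have hw2' : w * w = a * b + δ := by linarith
    have h4 : (2 * w) ^ 2 = (a + b + δ) ^ 2 := by rw [hs]
    rw [hs, hw2]
    nlinarith
  have hM : (1 + w) ^ 2 / 2 * ((1 + w) ^ 2 / 2) - (1 + a) ^ 2 / 2 * ((1 + b) ^ 2 / 2) =
      δ * ((2 + (a + b + 2 * w) + (a * b + w ^ 2)) / 2) := by
    have hw2 : w ^ 2 = a * b + δ := by linarith
    have e : (1 + w) ^ 2 = 1 + a + b + a * b + 2 * δ := by linarith
    rw [e, hs, hw2]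
    ring
  have hab2 : a * b ≤ 27 / 100 * (27 / 100) := mul_le_mul ha1 hb1 hb0 (by norm_num)
  have hww2 : w * w ≤ 27 / 100 * (27 / 100) := mul_le_mul hw1 hw1 hw0 (by norm_num)
  have hy : 0 ≤ (2 + (a + b + 2 * w) + (a * b + w ^ 2)) / 2 := by positivity
  have hlt : (2 + (a + b + 2 * w) + (a * b + w ^ 2)) / 2 <
      2 * (4 - 2 * (a + b + 2 * w) - 4 * (a * b + w ^ 2)) := by linarith
  have h1 := mul_le_mul_of_nonneg_right hRP (mul_nonneg hδ0.le hy)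
  have h2 := mul_lt_mul_of_pos_left (mul_lt_mul_of_pos_left hlt hδ0) hP
  rw [← hM] at h1
  have h3 := congrArg (fun t => P * t) hA
  have h4 := congrArg (fun t => P * t) hM
  linarith

theorem exists_const_boxForm_le {ι : Type*} [Fintype ι] (s : Finset ι) {v : ι → ℝ}
    (hv : ∀ j, v j ∈ Set.Icc (0 : ℝ) (27 / 100)) :
    ∃ t ∈ Set.Icc (0 : ℝ) (27 / 100), boxForm s (fun _ => t) ≤ boxForm s v := by
  classical
  set K : Set (ι → ℝ) := Set.pi Set.univ fun _ => Set.Icc (0 : ℝ) (27 / 100) with hK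
  have hKc : IsCompact K := isCompact_univ_pi fun _ => isCompact_Icc
  have hcont : ContinuousOn (boxForm s) K := by
    unfold boxForm
    have hne : ∀ u ∈ K, ∀ j ∈ s, 1 - u j ≠ 0 := fun u hu j _ => by
      have := (hu j trivial).2
      linarith
    have hdiv : ContinuousOn (fun u : ι → ℝ => ∏ j ∈ s, 2 / 3 / (1 - u j)) K :=
      continuousOn_finsetProd s fun j hj =>
        ContinuousOn.div (by fun_prop) (by fun_prop) fun u hu => hne u hu j hj
    exact ((by fun_prop :
      Continuous fun u : ι → ℝ => 2 * ∏ j ∈ s, (1 + 2 * u j ^ 2)).continuousOn.sub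
      (continuousOn_const.mul hdiv)).add
      (by fun_prop : Continuous fun u : ι → ℝ => ∏ j ∈ s, (1 + u j) ^ 2 / 2).continuousOn
  obtain ⟨u, huK, hmin⟩ := hKc.exists_isMinOn ⟨v, fun j _ => hv j⟩ hcont
  have hu : ∀ j, u j ∈ Set.Icc (0 : ℝ) (27 / 100) := fun j => huK j trivial
  have heq : ∀ i ∈ s, ∀ j ∈ s, u i = u j := by
    intro i hi j hj
    by_contra hne
    have hij : i ≠ j := fun h => hne (h ▸ rfl)
    have hi' : 0 < 1 - u i := by linarith [(hu i).2]
    have hj' : 0 < 1 - u j := by linarith [(hu j).2]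
    have hw : 1 - √((1 - u i) * (1 - u j)) ∈ Set.Icc (0 : ℝ) (27 / 100) := by
      constructor
      · have : √((1 - u i) * (1 - u j)) ≤ 1 := Real.sqrt_le_one.2
          (mul_le_one₀ (by linarith [(hu i).1]) hj'.le (by linarith [(hu j).1]))
        linarith
      · have : 73 / 100 ≤ √((1 - u i) * (1 - u j)) := Real.le_sqrt_of_sq_le (by
          nlinarith [(hu i).2, (hu j).2])
        linarith
    generalize hwdef : 1 - √((1 - u i) * (1 - u j)) = w at hw
    have hww : (1 - w) * (1 - w) = (1 - u i) * (1 - u j) := by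
      rw [← hwdef, sub_sub_cancel]
      exact Real.mul_self_sqrt (mul_nonneg hi'.le hj'.le)
    set u' := Function.update (Function.update u i w) j w with hu'
    have hu'K : u' ∈ K := by
      intro k _
      by_cases hkj : k = j
      · subst hkj; simpa [hu'] using hw
      by_cases hki : k = i
      · subst hki; simpa [hu', hkj] using hw
      · simpa [hu', hkj, hki] using hu k
    have hle : boxForm s u ≤ boxForm s u' := hmin hu'K
    have hjs : j ∈ s.erase i := Finset.mem_erase.2 ⟨hij.symm, hj⟩
    have hi1 : u' i = w := by simp [hu', hij]
    have hj1 : u' j = w := by simp [hu']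
    have hrest : ∀ k ∈ (s.erase i).erase j, u' k = u k := fun k hk => by
      simp only [Finset.mem_erase] at hk
      simp [hu', hk.1, hk.2.1]
    have hsplit : ∀ f : ℝ → ℝ, ∏ k ∈ s, f (u k) =
        f (u i) * (f (u j) * ∏ k ∈ (s.erase i).erase j, f (u k)) := fun f => by
      rw [Finset.mul_prod_erase (s.erase i) (fun k => f (u k)) hjs,
        Finset.mul_prod_erase s (fun k => f (u k)) hi]
    have hsplit' : ∀ f : ℝ → ℝ, ∏ k ∈ s, f (u' k) =
        f w * (f w * ∏ k ∈ (s.erase i).erase j, f (u k)) := fun f => by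
      rw [← Finset.mul_prod_erase s (fun k => f (u' k)) hi,
        ← Finset.mul_prod_erase (s.erase i) (fun k => f (u' k)) hjs, hi1, hj1]
      congr 2
      exact Finset.prod_congr rfl fun k hk => by rw [hrest k hk]
    have hlt := pair_smoothing (P := ∏ k ∈ (s.erase i).erase j, (1 + 2 * u k ^ 2))
      (Q := ∏ k ∈ (s.erase i).erase j, 2 / 3 / (1 - u k))
      (R := ∏ k ∈ (s.erase i).erase j, (1 + u k) ^ 2 / 2) (hu i) (hu j) hw hne hww
      (Finset.prod_pos fun k _ => by positivity)
      (Finset.prod_le_prod (fun k _ => by positivity) fun k _ => by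
        nlinarith [(hu k).1, (hu k).2])
    refine absurd hle (not_le.2 ?_)
    unfold boxForm
    rw [hsplit fun t => 1 + 2 * t ^ 2, hsplit fun t => 2 / 3 / (1 - t),
      hsplit fun t => (1 + t) ^ 2 / 2, hsplit' fun t => 1 + 2 * t ^ 2,
      hsplit' fun t => 2 / 3 / (1 - t), hsplit' fun t => (1 + t) ^ 2 / 2]
    exact hlt
  have hmin' : boxForm s u ≤ boxForm s v := hmin (fun j _ => hv j)
  rcases s.eq_empty_or_nonempty with rfl | ⟨i, hi⟩
  · exact ⟨0, ⟨le_rfl, by norm_num⟩, by simp [boxForm]⟩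
  · refine ⟨u i, hu i, le_of_eq_of_le ?_ hmin'⟩
    unfold boxForm
    congr 1
    · congr 2 <;> exact Finset.prod_congr rfl fun k hk => by rw [heq i hi k hk]
    · exact Finset.prod_congr rfl fun k hk => by rw [heq i hi k hk]

theorem Omega_eq_sum {x y : ℝ} (s : Finset ℤ) (h : ∀ n : ℤ, n ∉ s → 1 ≤ |x * n - y|) :
    Omega x y = ∑ n ∈ s, max 0 (1 - |x * (n : ℝ) - y|) ^ 2 :=
  tsum_eq_sum fun n hn => by rw [max_eq_left (by linarith [h n hn])]; norm_num

theorem summable_Omega {x : ℝ} (hx : 0 < x) (y : ℝ) :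
    Summable fun n : ℤ => max 0 (1 - |x * (n : ℝ) - y|) ^ 2 := by
  refine summable_of_ne_finset_zero (s := Finset.Icc ⌊(y - 1) / x⌋ ⌈(y + 1) / x⌉) fun n hn => ?_
  rw [max_eq_left, zero_pow two_ne_zero]
  by_contra! hlt
  obtain ⟨h₁, h₂⟩ := abs_lt.1 (show |x * (n : ℝ) - y| < 1 by linarith)
  refine hn (Finset.mem_Icc.2 ⟨?_, ?_⟩)
  · have h : (⌊(y - 1) / x⌋ : ℝ) ≤ n :=
      (Int.floor_le _).trans ((div_le_iff₀' hx).2 (by linarith))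
    exact_mod_cast h
  · have h : (n : ℝ) ≤ ⌈(y + 1) / x⌉ :=
      ((le_div_iff₀' hx).2 (by linarith)).trans (Int.le_ceil _)
    exact_mod_cast h

theorem sum_le_Omega {x : ℝ} (hx : 0 < x) (y : ℝ) (s : Finset ℤ) :
    ∑ n ∈ s, max 0 (1 - |x * (n : ℝ) - y|) ^ 2 ≤ Omega x y :=
  (summable_Omega hx y).sum_le_tsum s fun _ _ => sq_nonneg _

theorem sum_neg_one_zero_one (x : ℝ) (hx : 1 ≤ x) :
    ∑ n ∈ ({-1, 0, 1} : Finset ℤ), max 0 (1 - |1 / x * (n : ℝ) - 0|) ^ 2 =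
      1 + 2 * (1 - 1 / x) ^ 2 := by
  have h : 1 / x ≤ 1 := (div_le_one (by linarith)).2 hx
  have h0 : 0 ≤ 1 / x := by positivity
  simp only [Finset.sum_insert (show (-1 : ℤ) ∉ ({0, 1} : Finset ℤ) by decide),
    Finset.sum_insert (show (0 : ℤ) ∉ ({1} : Finset ℤ) by decide), Finset.sum_singleton]
  push_cast
  rw [show 1 / x * (-1) - 0 = -(1 / x) by ring, show 1 / x * 1 - 0 = 1 / x by ring,
    show 1 / x * 0 - 0 = (0 : ℝ) by ring, abs_neg, abs_of_nonneg h0, abs_zero,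
    max_eq_right (by linarith : 0 ≤ 1 - 1 / x), max_eq_right (by norm_num : (0 : ℝ) ≤ 1 - 0)]
  ring

theorem one_le_Omega_zero {x : ℝ} (hx : 0 < x) : 1 ≤ Omega x 0 := by
  simpa using sum_le_Omega hx 0 {0}

theorem le_Omega_zero {x : ℝ} (hx : 1 ≤ x) : 1 + 2 * (1 - 1 / x) ^ 2 ≤ Omega (1 / x) 0 :=
  (sum_neg_one_zero_one x hx).symm.le.trans (sum_le_Omega (by positivity) 0 _)

theorem Omega_zero_eq {x : ℝ} (hx : 1 ≤ x) (hx2 : x ≤ 2) :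
    Omega (1 / x) 0 = 1 + 2 * (1 - 1 / x) ^ 2 := by
  rw [← sum_neg_one_zero_one x hx]
  refine Omega_eq_sum _ fun n hn => ?_
  simp only [Finset.mem_insert, Finset.mem_singleton, not_or] at hn
  have hn2 : 2 ≤ |n| := by
    rcases abs_cases n with h | h <;> omega
  have hn2' : (2 : ℝ) ≤ |(n : ℝ)| := by exact_mod_cast hn2
  rw [sub_zero, abs_mul, abs_of_pos (by positivity : 0 < 1 / x), one_div_mul_eq_div,
    le_div_iff₀ (by positivity)]
  linarith

theorem trapezoid_sum_ge {x : ℝ} (hx : 0 < x) (K : ℕ) :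
    2 * x / 3 * (1 - (1 - K / x) ^ 3) + (1 - K / x) ^ 2 ≤
      1 + 2 * ∑ n ∈ Finset.range K, (1 - ((n : ℝ) + 1) / x) ^ 2 := by
  induction K with
  | zero => simp
  | succ K ih =>
    rw [Finset.sum_range_succ]
    obtain ⟨b, hb⟩ : ∃ b, b = 1 - ((K : ℝ) + 1) / x := ⟨_, rfl⟩
    have ha : 1 - (K : ℝ) / x = b + 1 / x := by rw [hb]; ring
    push_cast
    rw [← hb]
    rw [ha] at ih
    have : 2 * x / 3 * (1 - b ^ 3) = 2 * x / 3 * (1 - (b + 1 / x) ^ 3)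
        + 2 / 3 * ((b + 1 / x) ^ 2 + (b + 1 / x) * b + b ^ 2) := by
      field_simp
      ring
    nlinarith [sq_nonneg (1 / x)]

theorem two_thirds_le_Omega_zero {x : ℝ} (hx : 0 < x) : 2 * x / 3 ≤ Omega (1 / x) 0 := by
  have hs := summable_Omega (one_div_pos.2 hx) 0
  have hpos : Summable fun n : ℕ => max 0 (1 - |1 / x * (((n : ℤ) + 1 : ℤ) : ℝ) - 0|) ^ 2 :=
    hs.comp_injective (i := fun n : ℕ => ((n : ℤ) + 1)) fun a b h => by simpa using h
  have hneg : Summable fun n : ℕ => max 0 (1 - |1 / x * ((-((n : ℤ) + 1) : ℤ) : ℝ) - 0|) ^ 2 :=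
    hs.comp_injective (i := fun n : ℕ => -((n : ℤ) + 1)) fun a b h => by simpa using h
  have key := tsum_of_add_one_of_neg_add_one
    (f := fun n : ℤ => max 0 (1 - |1 / x * (n : ℝ) - 0|) ^ 2) hpos hneg
  have hterm : ∀ n ∈ Finset.range ⌊x⌋₊, ∀ t : ℝ, |t| = (n : ℝ) + 1 →
      (1 - ((n : ℝ) + 1) / x) ^ 2 = max 0 (1 - |1 / x * t - 0|) ^ 2 := fun n hn t ht => by
    have : ((n + 1 : ℕ) : ℝ) ≤ x :=
      (Nat.le_floor_iff hx.le).1 (Nat.succ_le_of_lt (Finset.mem_range.1 hn))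
    push_cast at this
    rw [sub_zero, abs_mul, abs_of_pos (one_div_pos.2 hx), ht, one_div_mul_eq_div,
      max_eq_right (by linarith [(div_le_one hx).2 this])]
  have h1 : ∑ n ∈ Finset.range ⌊x⌋₊, (1 - ((n : ℝ) + 1) / x) ^ 2 ≤ _ :=
    (Finset.sum_congr rfl fun n hn => hterm n hn _ (by
      push_cast; exact abs_of_nonneg (by positivity))).le.trans
    (hpos.sum_le_tsum (Finset.range ⌊x⌋₊) fun _ _ => sq_nonneg _)
  have h2 : ∑ n ∈ Finset.range ⌊x⌋₊, (1 - ((n : ℝ) + 1) / x) ^ 2 ≤ _ :=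
    (Finset.sum_congr rfl fun n hn => hterm n hn _ (by
      push_cast; rw [abs_neg]; exact abs_of_nonneg (by positivity))).le.trans
    (hneg.sum_le_tsum (Finset.range ⌊x⌋₊) fun _ _ => sq_nonneg _)
  have h0 : max 0 (1 - |1 / x * ((0 : ℤ) : ℝ) - 0|) ^ 2 = 1 := by simp
  have hO : Omega (1 / x) 0 = ∑' n : ℤ, max 0 (1 - |1 / x * (n : ℝ) - 0|) ^ 2 := rfl
  have htr := trapezoid_sum_ge hx ⌊x⌋₊
  have hb0 : 0 ≤ 1 - (⌊x⌋₊ : ℝ) / x := by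
    linarith [(div_le_one hx).2 (Nat.floor_le hx.le)]
  have hb1 : x * (1 - (⌊x⌋₊ : ℝ) / x) ≤ 1 := by
    rw [mul_sub, mul_div_cancel₀ _ hx.ne']
    linarith [Nat.lt_floor_add_one x]
  rw [hO, key, h0]
  nlinarith [mul_nonneg (sq_nonneg (1 - (⌊x⌋₊ : ℝ) / x)) (sub_nonneg.2 hb1),
    sq_nonneg (1 - (⌊x⌋₊ : ℝ) / x)]

theorem le_Omega {x : ℝ} (hx : 1 / 2 ≤ x) (z : ℝ) :
    2 * (1 - 1 / (2 * x)) ^ 2 ≤ Omega (1 / x) z := by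
  have hx0 : 0 < x := by linarith
  refine le_trans ?_ (sum_le_Omega (one_div_pos.2 hx0) z {⌊z * x⌋, ⌊z * x⌋ + 1})
  rw [Finset.sum_pair (by simp)]
  have e₁ : 1 - |1 / x * (⌊z * x⌋ : ℝ) - z| = 1 - Int.fract (z * x) / x := by
    rw [show 1 / x * (⌊z * x⌋ : ℝ) - z = -(Int.fract (z * x) / x) by
      unfold Int.fract; field_simp; ring, abs_neg,
      abs_of_nonneg (div_nonneg (Int.fract_nonneg _) hx0.le)]
  have e₂ : 1 - |1 / x * ((⌊z * x⌋ + 1 : ℤ) : ℝ) - z| = 1 - (1 - Int.fract (z * x)) / x := by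
    rw [show 1 / x * ((⌊z * x⌋ + 1 : ℤ) : ℝ) - z = (1 - Int.fract (z * x)) / x by
      unfold Int.fract; push_cast; field_simp; ring,
      abs_of_nonneg (div_nonneg (by linarith [Int.fract_lt_one (z * x)]) hx0.le)]
  rw [e₁, e₂]
  have hsum : 2 * (1 - 1 / (2 * x)) =
      (1 - Int.fract (z * x) / x) + (1 - (1 - Int.fract (z * x)) / x) := by field_simp; ring
  have hnn : 0 ≤ 1 - 1 / (2 * x) := by
    rw [sub_nonneg, div_le_one (by positivity)]; linarith
  have hle := add_le_add (le_max_right 0 (1 - Int.fract (z * x) / x))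
    (le_max_right 0 (1 - (1 - Int.fract (z * x)) / x))
  nlinarith [sq_nonneg (max 0 (1 - Int.fract (z * x) / x) -
    max 0 (1 - (1 - Int.fract (z * x)) / x))]

theorem Omega_half_eq {x : ℝ} (hx : 1 / 2 ≤ x) (hx2 : x ≤ 3 / 2) :
    Omega (1 / x) (1 / (2 * x)) = 2 * (1 - 1 / (2 * x)) ^ 2 := by
  have hx0 : 0 < x := by linarith
  have hnn : 0 ≤ 1 - 1 / (2 * x) := by
    rw [sub_nonneg, div_le_one (by positivity)]; linarith
  have hp : 0 < 1 / (2 * x) := by positivity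
  rw [Omega_eq_sum {0, 1} fun n hn => ?_]
  · rw [Finset.sum_pair (by decide)]
    push_cast
    rw [show 1 / x * 0 - 1 / (2 * x) = -(1 / (2 * x)) by ring,
      show 1 / x * 1 - 1 / (2 * x) = 1 / (2 * x) by field_simp; norm_num,
      abs_neg, abs_of_pos hp, max_eq_right hnn]
    ring
  · simp only [Finset.mem_insert, Finset.mem_singleton, not_or] at hn
    have h3 : 3 ≤ |2 * n - 1| := by rcases abs_cases (2 * n - 1) with h | h <;> omega
    have h3' : (3 : ℝ) ≤ |2 * (n : ℝ) - 1| := by exact_mod_cast h3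
    rw [show 1 / x * (n : ℝ) - 1 / (2 * x) = 1 / (2 * x) * (2 * n - 1) by field_simp, abs_mul,
      abs_of_pos hp, one_div_mul_eq_div, le_div_iff₀ (by positivity)]
    linarith

/-- An explicit lower bound for `Omega (1 / x) 0`. -/
noncomputable def lowA (x : ℝ) : ℝ :=
  if x ≤ 1 then 1 else if x ≤ 9 / 4 then 1 + 2 * (1 - 1 / x) ^ 2 else 2 * x / 3

/-- An explicit lower bound for `Omega (1 / x) z`, uniform in `z`. -/
noncomputable def lowM (x : ℝ) : ℝ := if x ≤ 1 / 2 then 0 else 2 * (1 - 1 / (2 * x)) ^ 2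

theorem lowA_le_Omega {x : ℝ} (hx : 0 < x) : lowA x ≤ Omega (1 / x) 0 := by
  unfold lowA
  split_ifs with h1 h2
  · exact one_le_Omega_zero (one_div_pos.2 hx)
  · exact le_Omega_zero (not_le.1 h1).le
  · exact two_thirds_le_Omega_zero hx

theorem lowM_le_Omega {x : ℝ} (hx : 0 < x) (z : ℝ) : lowM x ≤ Omega (1 / x) z := by
  unfold lowM
  split_ifs with h
  · simpa using sum_le_Omega (one_div_pos.2 hx) z ∅
  · exact le_Omega (not_le.1 h).le z

theorem lowM_nonneg (x : ℝ) : 0 ≤ lowM x := by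
  unfold lowM
  split_ifs <;> positivity

theorem one_le_lowA (x : ℝ) : 1 ≤ lowA x := by
  unfold lowA
  split_ifs
  · exact le_rfl
  · linarith [sq_nonneg (1 - 1 / x)]
  · linarith

theorem two_thirds_le_lowA (x : ℝ) : 2 * x / 3 ≤ lowA x := by
  unfold lowA
  split_ifs with h1 h2
  · linarith
  · push Not at h1
    obtain ⟨s, hs⟩ : ∃ s, s = 1 / x := ⟨_, rfl⟩
    have hsx : s * x = 1 := by rw [hs]; field_simp
    rw [← hs]
    have key : 2 * x ^ 3 / 3 ≤ (1 + 2 * (1 - s) ^ 2) * x ^ 2 := by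
      have : (1 + 2 * (1 - s) ^ 2) * x ^ 2 = x ^ 2 + 2 * (x - s * x) ^ 2 := by ring
      rw [this, hsx]
      nlinarith [mul_nonneg (sub_nonneg.2 h1.le) (sub_nonneg.2 h2), sq_nonneg (x - 2),
        sq_nonneg (x - 3 / 2)]
    have hx2 : 0 < x ^ 2 := by positivity
    refine le_of_mul_le_mul_right ?_ hx2
    linarith
  · exact le_rfl

theorem lowM_le {x : ℝ} (hx : 0 < x) : lowM x ≤ 2 * x / 3 := by
  unfold lowM
  split_ifs with h
  · positivity
  · push Not at h
    have key : 2 * (1 - 1 / (2 * x)) ^ 2 * x ^ 2 ≤ 2 * x / 3 * x ^ 2 := by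
      have : 2 * (1 - 1 / (2 * x)) ^ 2 * x ^ 2 = 2 * (x - 1 / 2) ^ 2 := by field_simp
      rw [this]
      nlinarith [sq_nonneg (x - 3 / 2), mul_nonneg hx.le (sq_nonneg (x - 3 / 2))]
    exact le_of_mul_le_mul_right key (by positivity)

theorem lowA_lowM_gap {x : ℝ} (hx : 0 < x) :
    463 / 400 ≤ 2 * lowA x - 2 * (2 * x / 3) + lowM x := by
  rcases le_or_gt x (1 / 2) with h | h
  · rw [lowA, if_pos (by linarith)]
    linarith [lowM_nonneg x]
  have hM : lowM x * x ^ 2 = 2 * (x - 1 / 2) ^ 2 := by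
    rw [lowM, if_neg (not_le.2 h)]
    field_simp
  have hx2 : 0 < x ^ 2 := by positivity
  refine le_of_mul_le_mul_right (a := x ^ 2) ?_ hx2
  unfold lowA
  split_ifs with h1 h2
  · nlinarith [sq_nonneg (x - 1), mul_nonneg hx.le (sq_nonneg (x - 1)),
      mul_nonneg (sub_nonneg.2 h1) hx2.le, mul_nonneg (sub_nonneg.2 h1) (sub_nonneg.2 h.le)]
  · have : (1 + 2 * (1 - 1 / x) ^ 2) * x ^ 2 = x ^ 2 + 2 * (x - 1) ^ 2 := by field_simp
    push Not at h1
    have key : 0 ≤ 2 * (x ^ 2 + 2 * (x - 1) ^ 2) - 4 * x ^ 3 / 3 + 2 * (x - 1 / 2) ^ 2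
        - 463 / 400 * x ^ 2 := by
      nlinarith [mul_nonneg (sub_nonneg.2 h2) (sq_nonneg (x - 1058 / 1000)),
        mul_nonneg (sub_nonneg.2 h1.le) (sub_nonneg.2 h2), sq_nonneg (x - 1058 / 1000)]
    linarith
  · push Not at h2
    nlinarith

/-- The objective function with every `Omega` replaced by its explicit lower bound. -/
noncomputable def lowForm {ι : Type*} (s : Finset ι) (x : ι → ℝ) : ℝ :=
  2 * ∏ j ∈ s, lowA (x j) - 2 * ∏ j ∈ s, 2 * x j / 3 + ∏ j ∈ s, lowM (x j)

theorem lowForm_erase {ι : Type*} [DecidableEq ι] {s : Finset ι} {x : ι → ℝ}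
    (hx : ∀ j ∈ s, 0 < x j) {i : ι} (hi : i ∈ s) {r : ℝ} (hr : r ≤ lowA (x i))
    (hr' : r ≤ 463 / 400) : r * lowForm (s.erase i) x ≤ lowForm s x :=
  prod_form_erase (fun j _ => two_thirds_le_lowA (x j)) (fun j hj => lowM_le (hx j hj))
    (fun j _ => lowM_nonneg (x j)) hi hr (hr'.trans (lowA_lowM_gap (hx i hi)))

theorem le_lowForm_of_card_le {ι : Type*} {c : ℝ} {n : ℕ}
    (h : ∀ s : Finset ι, s.card = n → ∀ x : ι → ℝ, (∀ j ∈ s, 0 < x j) → c ≤ lowForm s x)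
    (s : Finset ι) (hs : n ≤ s.card) (x : ι → ℝ) (hx : ∀ j ∈ s, 0 < x j) : c ≤ lowForm s x := by
  classical
  induction s using Finset.strongInduction with
  | H s ih =>
    rcases hs.eq_or_lt with heq | hlt
    · exact h s heq.symm x hx
    · obtain ⟨i, hi⟩ := Finset.card_pos.1 (Nat.zero_lt_of_lt hlt)
      have h1 := ih (s.erase i) (Finset.erase_ssubset hi)
        (by rw [Finset.card_erase_of_mem hi]; omega) fun j hj => hx j (Finset.mem_of_mem_erase hj)
      linarith [lowForm_erase hx hi (one_le_lowA (x i)) (by norm_num)]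

theorem boxForm_le_lowForm {ι : Type*} {s : Finset ι} {x : ι → ℝ} (hx : ∀ j ∈ s, 0 < x j)
    (hlt : ∀ j ∈ s, lowA (x j) < 229 / 200) :
    boxForm s (fun j => 1 - 1 / max (x j) 1) ≤ lowForm s x := by
  have hcase : ∀ j ∈ s, x j ≤ 1 ∨ (1 < x j ∧ x j ≤ 9 / 4) := fun j hj => by
    by_contra! hcon
    have := hlt j hj
    rw [lowA, if_neg (not_le.2 hcon.1), if_neg (not_le.2 (hcon.2 hcon.1))] at this
    linarith [hcon.2 hcon.1]
  have key := prod_form_mono (a := fun j => lowA (x j)) (d := fun j => 2 * x j / 3)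
    (m := fun j => lowM (x j)) (a' := fun j => lowA (max (x j) 1))
    (d' := fun j => 2 * max (x j) 1 / 3) (m' := fun j => lowM (max (x j) 1)) s
    (fun j _ => two_thirds_le_lowA _) (fun j hj => lowM_le (by positivity))
    (fun j _ => lowM_nonneg _) ?_ ?_ ?_ (fun j _ => two_thirds_le_lowA _)
    (fun j hj => lowM_le (hx j hj)) (fun j _ => lowM_nonneg _)
    (le_refl (1 : ℝ)) (le_refl (1 : ℝ)) zero_le_one
  · simp only [one_mul] at key
    refine le_of_eq_of_le ?_ key
    unfold boxForm
    congr 1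
    · congr 2
      · refine Finset.prod_congr rfl fun j hj => ?_
        beta_reduce
        rcases hcase j hj with h | h
        · rw [max_eq_right h, lowA, if_pos le_rfl]; norm_num
        · rw [max_eq_left h.1.le, lowA, if_neg (not_le.2 h.1), if_pos h.2]
      · refine Finset.prod_congr rfl fun j _ => ?_
        rw [sub_sub_cancel, div_div_eq_mul_div]
        ring
    · refine Finset.prod_congr rfl fun j _ => ?_
      have h1 : 1 ≤ max (x j) 1 := le_max_right _ _
      rw [lowM, if_neg (by linarith)]
      field_simp
      ring
  all_goals
    intro j hj
    rcases le_or_gt (x j) 1 with h | h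
    swap
    · rw [max_eq_left h.le]
    rw [max_eq_right h]
    have hA : lowA (x j) = 1 := if_pos h
    have hA1 : lowA 1 = 1 := if_pos le_rfl
    rw [hA, hA1]
  · linarith
  · have hM1 : lowM 1 = 1 / 2 := by rw [lowM, if_neg (by norm_num)]; norm_num
    rw [hM1]
    rcases le_or_gt (x j) (1 / 2) with h' | h'
    · linarith [lowM_nonneg (x j)]
    · have hM : lowM (x j) * x j ^ 2 = 2 * (x j - 1 / 2) ^ 2 := by
        have := hx j hj
        rw [lowM, if_neg (not_le.2 h')]
        field_simp
      have hx2 : 0 < x j ^ 2 := pow_pos (hx j hj) 2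
      refine le_of_mul_le_mul_right (a := x j ^ 2) ?_ hx2
      nlinarith [mul_nonneg (sub_nonneg.2 h) (sq_nonneg (x j - 3 / 4)),
        mul_nonneg (sub_nonneg.2 h) (sub_nonneg.2 h'.le)]

theorem lowForm_step {ι : Type*} [Fintype ι] {c c' r : ℝ} {n : ℕ}
    (h : ∀ s : Finset ι, s.card = n → ∀ x : ι → ℝ, (∀ j ∈ s, 0 < x j) → c ≤ lowForm s x)
    (hr0 : 0 ≤ r) (hr : r ≤ 229 / 200) (hc : c' ≤ r * c)
    (hbox : ∀ t : ℝ, 0 ≤ t → t ≤ 27 / 100 → c' ≤ 2 * (1 + 2 * t ^ 2) ^ (n + 1)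
      - 2 * (2 / 3 / (1 - t)) ^ (n + 1) + ((1 + t) ^ 2 / 2) ^ (n + 1))
    (s : Finset ι) (hs : s.card = n + 1) (x : ι → ℝ) (hx : ∀ j ∈ s, 0 < x j) :
    c' ≤ lowForm s x := by
  classical
  by_cases hlarge : ∃ i ∈ s, r ≤ lowA (x i)
  · obtain ⟨i, hi, hri⟩ := hlarge
    have h1 := h (s.erase i) (by rw [Finset.card_erase_of_mem hi]; omega) x
      fun j hj => hx j (Finset.mem_of_mem_erase hj)
    exact hc.trans ((mul_le_mul_of_nonneg_left h1 hr0).trans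
      (lowForm_erase hx hi hri (by linarith)))
  push Not at hlarge
  have hlt : ∀ j ∈ s, lowA (x j) < 229 / 200 := fun j hj => (hlarge j hj).trans_le hr
  have hbf := boxForm_le_lowForm hx hlt
  set v : ι → ℝ := fun j => if j ∈ s then 1 - 1 / max (x j) 1 else 0 with hv
  have hvs : boxForm s v = boxForm s (fun j => 1 - 1 / max (x j) 1) := by
    unfold boxForm
    congr 1
    · congr 2 <;> exact Finset.prod_congr rfl fun j hj => by simp only [hv, if_pos hj]
    · exact Finset.prod_congr rfl fun j hj => by simp only [hv, if_pos hj]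
  have hvmem : ∀ j, v j ∈ Set.Icc (0 : ℝ) (27 / 100) := fun j => by
    by_cases hj : j ∈ s
    swap
    · simp only [hv, if_neg hj]
      norm_num
    simp only [hv, if_pos hj]
    refine ⟨sub_nonneg.2 ((div_le_one (by positivity)).2 (le_max_right _ _)), ?_⟩
    rcases le_or_gt (x j) 1 with h1 | h1
    · rw [max_eq_right h1]; norm_num
    have h2 := hlt j hj
    rw [max_eq_left h1.le]
    rw [lowA, if_neg (not_le.2 h1)] at h2
    split_ifs at h2 with h3
    · by_contra! h4
      nlinarith
    · push Not at h3
      linarith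
  obtain ⟨t, ht, htle⟩ := exists_const_boxForm_le s hvmem
  have := hbox t ht.1 ht.2
  simp only [boxForm, Finset.prod_const, hs] at htle
  unfold boxForm at hvs hbf
  linarith

theorem lowForm_card_one {ι : Type*} (s : Finset ι) (hs : s.card = 1) (x : ι → ℝ)
    (hx : ∀ j ∈ s, 0 < x j) : 463 / 400 ≤ lowForm s x := by
  obtain ⟨i, rfl⟩ := Finset.card_eq_one.1 hs
  simpa [lowForm] using lowA_lowM_gap (hx i (Finset.mem_singleton_self i))

theorem lowForm_card_two {ι : Type*} [Fintype ι] (s : Finset ι) (hs : s.card = 2) (x : ι → ℝ)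
    (hx : ∀ j ∈ s, 0 < x j) : 1325 / 1000 ≤ lowForm s x :=
  lowForm_step lowForm_card_one (r := 229 / 200) (by norm_num) (by norm_num) (by norm_num)
    (fun _ => univariate_two) s hs x hx

theorem lowForm_card_three {ι : Type*} [Fintype ι] (s : Finset ι) (hs : s.card = 3)
    (x : ι → ℝ) (hx : ∀ j ∈ s, 0 < x j) : 1497 / 1000 ≤ lowForm s x :=
  lowForm_step lowForm_card_two (r := 229 / 200) (by norm_num) (by norm_num) (by norm_num)
    (fun _ => univariate_three) s hs x hx

theorem lowForm_card_four {ι : Type*} [Fintype ι] (s : Finset ι) (hs : s.card = 4)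
    (x : ι → ℝ) (hx : ∀ j ∈ s, 0 < x j) : 1641 / 1000 ≤ lowForm s x :=
  lowForm_step lowForm_card_three (r := 229 / 200) (by norm_num) (by norm_num) (by norm_num)
    (fun _ => univariate_four) s hs x hx

theorem lowForm_card_five {ι : Type*} [Fintype ι] (s : Finset ι) (hs : s.card = 5)
    (x : ι → ℝ) (hx : ∀ j ∈ s, 0 < x j) : 1751 / 1000 ≤ lowForm s x :=
  lowForm_step lowForm_card_four (r := 229 / 200) (by norm_num) (by norm_num) (by norm_num)
    (fun _ => univariate_five) s hs x hx

theorem two_thirds_prod {e : ℕ} (x : Fin e → ℝ) :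
    -((2 : ℝ) ^ (e + 1) / 3 ^ e) * ∏ j, x j = -(2 * ∏ j, 2 * x j / 3) := by
  have : ∏ j, 2 * x j / 3 = (2 / 3) ^ e * ∏ j, x j := by
    rw [show (fun j => 2 * x j / 3) = fun j => 2 / 3 * x j by funext j; ring,
      Finset.prod_mul_distrib]
    simp [div_pow]
  rw [this, div_pow, pow_succ]
  ring

theorem lowForm_le {e : ℕ} {x : Fin e → ℝ} (hx : ∀ j, 0 < x j) (y : Fin e → ℝ) :
    lowForm Finset.univ x ≤ -((2 : ℝ) ^ (e + 1) / 3 ^ e) * ∏ j, x j +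
      2 * ∏ j, Omega (1 / x j) 0 + ∏ j, Omega (1 / x j) (1 + 2 * y j / x j) := by
  rw [two_thirds_prod, lowForm]
  have h1 : ∏ j, lowA (x j) ≤ ∏ j, Omega (1 / x j) 0 :=
    Finset.prod_le_prod (fun j _ => zero_le_one.trans (one_le_lowA _))
      fun j _ => lowA_le_Omega (hx j)
  have h2 : ∏ j, lowM (x j) ≤ ∏ j, Omega (1 / x j) (1 + 2 * y j / x j) :=
    Finset.prod_le_prod (fun j _ => lowM_nonneg _) fun j _ => lowM_le_Omega (hx j) _
  linarith

theorem le_Bquart {e : ℕ} {c : ℝ}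
    (h : ∀ x : Fin e → ℝ, (∀ j, 0 < x j) → c ≤ lowForm Finset.univ x) : c ≤ Bquart e := by
  refine le_csInf ⟨_, fun _ => 1, fun _ => 0, fun _ => one_pos, rfl⟩ ?_
  rintro r ⟨x, y, hx, rfl⟩
  exact (h x hx).trans (lowForm_le hx y)

theorem Bquart_le {e : ℕ} {x : ℝ} (hx : 0 < x) (z : ℝ) :
    Bquart e ≤ -2 * (2 * x / 3) ^ e + 2 * Omega (1 / x) 0 ^ e + Omega (1 / x) z ^ e := by
  refine csInf_le ⟨0, ?_⟩ ⟨fun _ => x, fun _ => (z - 1) * x / 2, fun _ => hx, ?_⟩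
  · rintro r ⟨x, y, hx, rfl⟩
    refine le_trans ?_ (lowForm_le hx y)
    have h1 : ∏ j, 2 * x j / 3 ≤ ∏ j, lowA (x j) :=
      Finset.prod_le_prod (fun j _ => by have := hx j; positivity)
        fun j _ => two_thirds_le_lowA _
    have h2 : 0 ≤ ∏ j, lowM (x j) := Finset.prod_nonneg fun j _ => lowM_nonneg _
    unfold lowForm
    linarith
  · simp only [two_thirds_prod]
    rw [show 1 + 2 * ((z - 1) * x / 2) / x = z by field_simp; ring]
    simp [div_pow]

theorem Bquart_le_of_one_le {e : ℕ} {x : ℝ} (hx : 1 ≤ x) (hx2 : x ≤ 3 / 2) :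
    Bquart e ≤ -2 * (2 * x / 3) ^ e + 2 * (1 + 2 * (1 - 1 / x) ^ 2) ^ e +
      (2 * (1 - 1 / (2 * x)) ^ 2) ^ e := by
  have := Bquart_le (e := e) (x := x) (by linarith) (1 / (2 * x))
  rwa [Omega_zero_eq hx (by linarith), Omega_half_eq (by linarith) hx2] at this

theorem Bquart_lt_two (e : ℕ) (he : e ≠ 0) : Bquart e < 2 := by
  have h := Bquart_le (e := e) (x := 1 / 2) (by norm_num) (1 / (2 * (1 / 2)))
  rw [Omega_half_eq le_rfl (by norm_num)] at h
  have h0 : Omega (1 / (1 / 2)) 0 = 1 := by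
    rw [Omega_eq_sum {0} fun n hn => ?_]
    · simp
    · have h1 : 1 ≤ |n| := Int.one_le_abs (by simpa using hn)
      have h1' : (1 : ℝ) ≤ |(n : ℝ)| := by exact_mod_cast h1
      rw [sub_zero, abs_mul, abs_of_pos (by norm_num)]
      linarith
  rw [h0] at h
  norm_num [he] at h
  have : (0 : ℝ) < (1 / 3) ^ e := by positivity
  linarith

theorem Bconst_bounds {e : ℕ} {a b : ℝ} (ha : 0 ≤ a) (h₁ : a < Bquart e) (h₂ : Bquart e < b) :
    a ^ ((1 : ℝ) / 4) < Bconst e ∧ Bconst e < b ^ ((1 : ℝ) / 4) :=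
  ⟨Real.rpow_lt_rpow ha h₁ (by norm_num),
    Real.rpow_lt_rpow (ha.trans h₁.le) h₂ (by norm_num)⟩

/-- numerical bounds on `B_1, …, B_5` and on `B_e` for `e ≥ 6`. -/
theorem stmt_14 :
    ((103 / 89 : ℝ) ^ ((1 : ℝ) / 4) < Bconst 1 ∧ Bconst 1 < (22 / 19 : ℝ) ^ ((1 : ℝ) / 4)) ∧
    ((86 / 65 : ℝ) ^ ((1 : ℝ) / 4) < Bconst 2 ∧ Bconst 2 < (75 / 56 : ℝ) ^ ((1 : ℝ) / 4)) ∧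
    ((142 / 95 : ℝ) ^ ((1 : ℝ) / 4) < Bconst 3 ∧ Bconst 3 < (116 / 77 : ℝ) ^ ((1 : ℝ) / 4)) ∧
    ((100 / 61 : ℝ) ^ ((1 : ℝ) / 4) < Bconst 4 ∧ Bconst 4 < (107 / 65 : ℝ) ^ ((1 : ℝ) / 4)) ∧
    ((7 / 4 : ℝ) ^ ((1 : ℝ) / 4) < Bconst 5 ∧ Bconst 5 < (128 / 73 : ℝ) ^ ((1 : ℝ) / 4)) ∧
    (∀ e : ℕ, 6 ≤ e →
      (7 / 4 : ℝ) ^ ((1 : ℝ) / 4) < Bconst e ∧ Bconst e < (2 : ℝ) ^ ((1 : ℝ) / 4)) := by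
  refine ⟨Bconst_bounds (by norm_num) ?_ ?_, Bconst_bounds (by norm_num) ?_ ?_,
    Bconst_bounds (by norm_num) ?_ ?_, Bconst_bounds (by norm_num) ?_ ?_,
    Bconst_bounds (by norm_num) ?_ ?_,
    fun e he => Bconst_bounds (by norm_num) ?_ (Bquart_lt_two e (by omega))⟩
  · exact lt_of_lt_of_le (by norm_num)
      (le_Bquart fun x hx => lowForm_card_one Finset.univ (by simp) x fun j _ => hx j)
  · refine (Bquart_le_of_one_le (x := 1 / (1 - 55 / 1000)) ?_ ?_).trans_lt ?_ <;> norm_num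
  · exact lt_of_lt_of_le (by norm_num)
      (le_Bquart fun x hx => lowForm_card_two Finset.univ (by simp) x fun j _ => hx j)
  · refine (Bquart_le_of_one_le (x := 1 / (1 - 58 / 1000)) ?_ ?_).trans_lt ?_ <;> norm_num
  · exact lt_of_lt_of_le (by norm_num)
      (le_Bquart fun x hx => lowForm_card_three Finset.univ (by simp) x fun j _ => hx j)
  · refine (Bquart_le_of_one_le (x := 1 / (1 - 507 / 10000)) ?_ ?_).trans_lt ?_ <;> norm_num
  · exact lt_of_lt_of_le (by norm_num)
      (le_Bquart fun x hx => lowForm_card_four Finset.univ (by simp) x fun j _ => hx j)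
  · refine (Bquart_le_of_one_le (x := 1 / (1 - 395 / 10000)) ?_ ?_).trans_lt ?_ <;> norm_num
  · exact lt_of_lt_of_le (by norm_num)
      (le_Bquart fun x hx => lowForm_card_five Finset.univ (by simp) x fun j _ => hx j)
  · refine (Bquart_le_of_one_le (x := 1 / (1 - 29 / 1000)) ?_ ?_).trans_lt ?_ <;> norm_num
  · exact lt_of_lt_of_le (by norm_num)
      (le_Bquart fun x hx => le_lowForm_of_card_le lowForm_card_five Finset.univ
        (by simp; omega) x fun j _ => hx j)
end

section
/- Let x be a fixed nonzero real number and consider Ω(x,y) as a function of y ∈ ℝ. (i) If |x| ≥ 2, then the global minimum value of y ↦ Ω(x,y) is 0, and it is attained exactly for y ∈ ⋃_{m∈ℤ} [m|x| + 1, (m+1)|x| − 1]. (ii) If 0 < |x| ≤ 2, then the global minimum value of y ↦ Ω(x,y) is Ω(x, x/2) = ∑_{n∈ℤ} max(0, 1 − |(n + 1/2)x|)^2, and it is attained exactly for y ∈ {x(m + 1/2) : m ∈ ℤ}. -/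
theorem Omega_summable {x : ℝ} (hx : x ≠ 0) (y : ℝ) :
    Summable fun n : ℤ => max 0 (1 - |x * (n : ℝ) - y|) ^ 2 := by
  apply summable_of_hasFiniteSupport
  refine (Set.finite_Icc ⌊y / x - 1 / |x|⌋ ⌈y / x + 1 / |x|⌉).subset fun n hn => ?_
  have hlt : |x * (n : ℝ) - y| < 1 := by
    by_contra! h
    exact hn (by simp [max_eq_left (sub_nonpos.2 h)])
  have hx' : 0 < |x| := abs_pos.2 hx
  have hdist : |(n : ℝ) - y / x| ≤ 1 / |x| := by
    rw [le_div_iff₀ hx', ← abs_mul]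
    have : ((n : ℝ) - y / x) * x = x * n - y := by field_simp
    rw [this]
    exact hlt.le
  obtain ⟨h1, h2⟩ := abs_le.1 hdist
  constructor
  · have := Int.floor_le (y / x - 1 / |x|)
    exact_mod_cast (by linarith : (⌊y / x - 1 / |x|⌋ : ℝ) ≤ n)
  · have := Int.le_ceil (y / x + 1 / |x|)
    exact_mod_cast (by linarith : (n : ℝ) ≤ ⌈y / x + 1 / |x|⌉)

theorem Omega_nonneg (x y : ℝ) : 0 ≤ Omega x y :=
  tsum_nonneg fun _ => sq_nonneg _

theorem Omega_eq_zero_iff {x : ℝ} (hx : x ≠ 0) (y : ℝ) :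
    Omega x y = 0 ↔ ∀ n : ℤ, 1 ≤ |x * (n : ℝ) - y| := by
  unfold Omega
  rw [← (Omega_summable hx y).hasSum_iff, hasSum_zero_iff_of_nonneg fun _ => sq_nonneg _,
    funext_iff]
  simp

/-- Being at distance at least `1` from `xℤ` only depends on `|x|`. -/
theorem forall_one_le_abs_mul_sub_iff {x : ℝ} (hx : x ≠ 0) (y : ℝ) :
    (∀ n : ℤ, 1 ≤ |x * (n : ℝ) - y|) ↔
      ∃ m : ℤ, y ∈ Set.Icc ((m : ℝ) * |x| + 1) (((m : ℝ) + 1) * |x| - 1) := by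
  have hsign : (∀ n : ℤ, 1 ≤ |x * (n : ℝ) - y|) ↔ ∀ n : ℤ, 1 ≤ |(|x|) * (n : ℝ) - y| := by
    rcases abs_choice x with h | h <;> rw [h]
    constructor <;> intro H n <;> simpa using H (-n)
  have hx' : 0 < |x| := abs_pos.2 hx
  rw [hsign]
  constructor
  · intro H
    refine ⟨⌊y / |x|⌋, ?_⟩
    have h1 : (⌊y / |x|⌋ : ℝ) * |x| ≤ y := (le_div_iff₀ hx').1 (Int.floor_le _)
    have h2 : y < (⌊y / |x|⌋ + 1 : ℝ) * |x| := (div_lt_iff₀ hx').1 (Int.lt_floor_add_one _)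
    have h3 := H ⌊y / |x|⌋
    have h4 := H (⌊y / |x|⌋ + 1)
    push_cast at h4
    rw [abs_of_nonpos (by linarith)] at h3
    rw [abs_of_nonneg (by linarith)] at h4
    constructor <;> linarith
  · rintro ⟨m, h1, h2⟩ n
    rcases le_or_gt n m with h | h
    · have : (n : ℝ) ≤ m := by exact_mod_cast h
      exact le_abs.2 (Or.inr (by nlinarith))
    · have : (m : ℝ) + 1 ≤ n := by exact_mod_cast h
      exact le_abs.2 (Or.inl (by nlinarith))

theorem Omega_add_int_mul (x y : ℝ) (m : ℤ) : Omega x (y + x * m) = Omega x y := by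
  unfold Omega
  rw [← (Equiv.addRight m).tsum_eq]
  refine tsum_congr fun n => ?_
  simp only [Equiv.coe_addRight, Int.cast_add]
  ring_nf

theorem Omega_sub_self (x y : ℝ) : Omega x (x - y) = Omega x y := by
  unfold Omega
  rw [← (Equiv.subLeft (1 : ℤ)).tsum_eq]
  refine tsum_congr fun n => ?_
  rw [← abs_neg]
  simp only [Equiv.subLeft_apply, Int.cast_sub, Int.cast_one]
  ring_nf

theorem abs_midpoint_of_mul_nonneg {a b : ℝ} (h : 0 ≤ a * b) :
    |(a + b) / 2| = (|a| + |b|) / 2 := by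
  rw [abs_div, abs_two, abs_add_eq_add_abs_iff a b |>.2 (mul_nonneg_iff.1 h)]

/-- The truncated parabola `t ↦ max 0 (1 - |t|) ^ 2` is midpoint convex on each half-line. -/
theorem two_mul_sq_max_midpoint_le {a b : ℝ} (h : 0 ≤ a * b) :
    2 * max 0 (1 - |(a + b) / 2|) ^ 2 ≤ max 0 (1 - |a|) ^ 2 + max 0 (1 - |b|) ^ 2 := by
  rw [abs_midpoint_of_mul_nonneg h]
  set p := max 0 (1 - |a|)
  set q := max 0 (1 - |b|)
  have hp : 0 ≤ p := le_max_left _ _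
  have hq : 0 ≤ q := le_max_left _ _
  have hpa : 1 - |a| ≤ p := le_max_right _ _
  have hqb : 1 - |b| ≤ q := le_max_right _ _
  have hr : max 0 (1 - (|a| + |b|) / 2) ≤ (p + q) / 2 := max_le (by linarith) (by linarith)
  have hr0 : 0 ≤ max 0 (1 - (|a| + |b|) / 2) := le_max_left _ _
  nlinarith [sq_nonneg (p - q), pow_le_pow_left₀ hr0 hr 2]

theorem two_mul_sq_max_midpoint_lt {a b : ℝ} (h : 0 ≤ a * b) (hab : a ≠ b)
    (hle : |(a + b) / 2| ≤ 1) :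
    2 * max 0 (1 - |(a + b) / 2|) ^ 2 < max 0 (1 - |a|) ^ 2 + max 0 (1 - |b|) ^ 2 := by
  have habs : |a| ≠ |b| := by
    intro he
    rcases abs_eq_abs.1 he with h' | h'
    · exact hab h'
    · have : b = 0 := by subst h'; nlinarith
      exact hab (by rw [h', this, neg_zero])
  rw [abs_midpoint_of_mul_nonneg h] at *
  rw [max_eq_right (by linarith : 0 ≤ 1 - (|a| + |b|) / 2)]
  set p := max 0 (1 - |a|) with hpdef
  set q := max 0 (1 - |b|) with hqdef
  have hpa : 1 - |a| ≤ p := le_max_right _ _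
  have hqb : 1 - |b| ≤ q := le_max_right _ _
  have hpq : p ≠ q := by
    intro he
    rcases lt_or_gt_of_ne habs with hl | hl
    · rw [hpdef, max_eq_right (by linarith)] at he
      rcases max_choice 0 (1 - |b|) with hc | hc <;> rw [hqdef, hc] at he <;> linarith
    · rw [hqdef, max_eq_right (by linarith)] at he
      rcases max_choice 0 (1 - |a|) with hc | hc <;> rw [hpdef, hc] at he <;> linarith
  have hr : 1 - (|a| + |b|) / 2 ≤ (p + q) / 2 := by linarith
  nlinarith [sq_pos_of_ne_zero (sub_ne_zero.2 hpq), pow_le_pow_left₀ (by linarith) hr 2]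

theorem int_sub_mul_int_sub_nonneg {t : ℝ} (h0 : 0 ≤ t) (h1 : t ≤ 1) (n : ℤ) :
    0 ≤ ((n : ℝ) - t) * (n - 1 + t) := by
  rcases le_or_gt n 0 with h | h
  · have : (n : ℝ) ≤ 0 := by exact_mod_cast h
    exact mul_nonneg_of_nonpos_of_nonpos (by linarith) (by linarith)
  · have : (1 : ℝ) ≤ n := by exact_mod_cast h
    exact mul_nonneg (by linarith) (by linarith)

theorem mul_int_sub_mul_nonneg (x : ℝ) {t : ℝ} (h0 : 0 ≤ t) (h1 : t ≤ 1) (n : ℤ) :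
    0 ≤ (x * n - x * t) * (x * n - (x - x * t)) := by
  have := mul_nonneg (sq_nonneg x) (int_sub_mul_int_sub_nonneg h0 h1 n)
  linarith

theorem Omega_half_lt {x : ℝ} (hx : x ≠ 0) (hx2 : |x| ≤ 2) {t : ℝ} (h0 : 0 ≤ t) (h1 : t ≤ 1)
    (ht : t ≠ 1 / 2) : Omega x (x / 2) < Omega x (x * t) := by
  have hmid (n : ℤ) : x * (n : ℝ) - x / 2 = ((x * n - x * t) + (x * n - (x - x * t))) / 2 := by
    ring
  have hsum : 2 * Omega x (x / 2) < Omega x (x * t) + Omega x (x - x * t) := by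
    unfold Omega
    rw [← tsum_mul_left, ← (Omega_summable hx _).tsum_add (Omega_summable hx _)]
    refine Summable.tsum_lt_tsum (i := 0) (fun n => ?_) ?_
      ((Omega_summable hx _).mul_left 2) ((Omega_summable hx _).add (Omega_summable hx _))
    · simp only [hmid]
      exact two_mul_sq_max_midpoint_le (mul_int_sub_mul_nonneg x h0 h1 n)
    · simp only [hmid]
      refine two_mul_sq_max_midpoint_lt (mul_int_sub_mul_nonneg x h0 h1 0) (fun h => ht ?_) ?_
      · exact mul_left_cancel₀ hx (by linarith)
      · rw [← hmid, Int.cast_zero, mul_zero, zero_sub, abs_neg, abs_div, abs_two]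
        linarith
  rw [Omega_sub_self] at hsum
  linarith

theorem Omega_half_lt_of_ne {x : ℝ} (hx : x ≠ 0) (hx2 : |x| ≤ 2) {y : ℝ}
    (hy : ¬∃ m : ℤ, y = x * ((m : ℝ) + 1 / 2)) : Omega x (x / 2) < Omega x y := by
  have hdecomp : y = x * Int.fract (y / x) + x * ⌊y / x⌋ := by
    rw [← mul_add, Int.fract_add_floor]
    field_simp
  rw [hdecomp, Omega_add_int_mul]
  refine Omega_half_lt hx hx2 (Int.fract_nonneg _) (Int.fract_lt_one _).le fun h => hy ?_
  refine ⟨⌊y / x⌋, ?_⟩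
  rw [h] at hdecomp
  linarith

theorem Omega_mul_int_add_half (x : ℝ) (m : ℤ) :
    Omega x (x * ((m : ℝ) + 1 / 2)) = Omega x (x / 2) := by
  rw [← Omega_add_int_mul x (x / 2) m]
  ring_nf

theorem Omega_half_eq_tsum (x : ℝ) :
    Omega x (x / 2) = ∑' n : ℤ, max 0 (1 - |((n : ℝ) + 1 / 2) * x|) ^ 2 := by
  unfold Omega
  rw [← (Equiv.addRight (1 : ℤ)).tsum_eq]
  refine tsum_congr fun n => ?_
  simp only [Equiv.coe_addRight, Int.cast_add, Int.cast_one]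
  ring_nf

/-- for fixed nonzero `x`, the global minima of `y ↦ Omega x y`.
(i) If `|x| ≥ 2` the minimum value is `0`, attained exactly for
`y ∈ ⋃_{m ∈ ℤ} [m|x|+1, (m+1)|x|-1]`.
(ii) If `0 < |x| ≤ 2` the minimum value is `Omega x (x/2) = ∑_{n ∈ ℤ} max(0, 1-|(n+1/2)x|)²`,
attained exactly for `y ∈ {x(m+1/2) : m ∈ ℤ}`. -/
theorem stmt_17 (x : ℝ) (hx : x ≠ 0) :
    (2 ≤ |x| →
      (∀ y : ℝ, 0 ≤ Omega x y) ∧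
      (∀ y : ℝ, Omega x y = 0 ↔
        ∃ m : ℤ, y ∈ Set.Icc ((m : ℝ) * |x| + 1) (((m : ℝ) + 1) * |x| - 1))) ∧
    (|x| ≤ 2 →
      Omega x (x / 2) = (∑' n : ℤ, max 0 (1 - |((n : ℝ) + 1 / 2) * x|) ^ 2) ∧
      (∀ y : ℝ, Omega x (x / 2) ≤ Omega x y) ∧
      (∀ y : ℝ, Omega x y = Omega x (x / 2) ↔ ∃ m : ℤ, y = x * ((m : ℝ) + 1 / 2))) := by
  refine ⟨fun _ => ⟨Omega_nonneg x, fun y =>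
    (Omega_eq_zero_iff hx y).trans (forall_one_le_abs_mul_sub_iff hx y)⟩, fun hx2 =>
    ⟨Omega_half_eq_tsum x, fun y => ?_, fun y => ⟨fun h => ?_, ?_⟩⟩⟩
  · by_cases hy : ∃ m : ℤ, y = x * ((m : ℝ) + 1 / 2)
    · obtain ⟨m, rfl⟩ := hy
      exact (Omega_mul_int_add_half x m).ge
    · exact (Omega_half_lt_of_ne hx hx2 hy).le
  · by_contra hy
    exact (Omega_half_lt_of_ne hx hx2 hy).ne' h
  · rintro ⟨m, rfl⟩
    exact Omega_mul_int_add_half x m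
end
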